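/- The six vector spaces V₁, V₂, V₃, V₁^{|S|−1}, V₂^{|S|−1} and V₃^{|S|−1} are all equal. -/

import Mathlib

open Matrix

/-- A labelled Markov decision process: a partial probabilistic transition function
`phi : S × A ⇀ (S → ℝ)` and a labelling function. -/
structure MDP (S A L : Type) where
  phi : S → A → Option (S → ℝ)
  label : S → L

namespace MDP

variable {S A L : Type} [Fintype S] [Fintype A] [DecidableEq S]

/-- The MDP data is well-formed: every state has an available action, and every
defined `phi s m` is a probability distribution on `S`. -/
def IsValid (D : MDP S A L) : Prop :=
  (∀ s, ∃ m, (D.phi s m).isSome) ∧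
    ∀ s m d, D.phi s m = some d → (∀ t, 0 ≤ d t) ∧ (∑ t, d t) = 1

/-- Transition probabilities, with `0` for unavailable actions. -/
def trans (D : MDP S A L) (s : S) (m : A) : S → ℝ :=
  (D.phi s m).getD 0

/-- A memoryless strategy: for each state a probability distribution on the
available actions. -/
def IsStrategy (D : MDP S A L) (α : S → A → ℝ) : Prop :=
  ∀ s, (∀ m, 0 ≤ α s m) ∧ (∑ m, α s m) = 1 ∧ ∀ m, D.phi s m = none → α s m = 0

/-- Transition probabilities of the induced labelled Markov chain `D(α)`. -/
def tau (D : MDP S A L) (α : S → A → ℝ) (s t : S) : ℝ :=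
  ∑ m, α s m * D.trans s m t

/-- The matrix `M_α(a)`. -/
def Mmat [DecidableEq L] (D : MDP S A L) (α : S → A → ℝ) (a : L) : Matrix S S ℝ :=
  Matrix.of fun s t => if D.label s = a then D.tau α s t else 0

/-- The matrix `M_α(w)` for a word `w ∈ L*` (identity for the empty word). -/
def Mword [DecidableEq L] (D : MDP S A L) (α : S → A → ℝ) (w : List L) : Matrix S S ℝ :=
  (w.map (D.Mmat α)).prod

/-- A memoryless deterministic (MD) strategy, viewed as a function `S → A`
choosing an available action in each state. -/
def IsMD (D : MDP S A L) (β : S → A) : Prop := ∀ s, (D.phi s (β s)).isSome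

/-- The memoryless strategy corresponding to an MD strategy. -/
def mdStrat [DecidableEq A] (β : S → A) : S → A → ℝ :=
  fun s m => if m = β s then 1 else 0

end MDP

namespace MDP

variable {S A L : Type} [Fintype S] [Fintype A] [Fintype L]
  [DecidableEq S] [DecidableEq A] [DecidableEq L]

/-- The column-vector space
`V₁^j = span{M_{α₁}(a₁)⋯M_{α_k}(a_k)·1 : k ≤ j, αᵢ memoryless strategies, aᵢ ∈ L}`. -/
def V1le (D : MDP S A L) (j : ℕ) : Submodule ℝ (S → ℝ) :=
  Submodule.span ℝ
    {v | ∃ k : ℕ, k ≤ j ∧ ∃ (αs : Fin k → S → A → ℝ) (as : Fin k → L),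
      (∀ i, D.IsStrategy (αs i)) ∧
      v = ((List.ofFn fun i => D.Mmat (αs i) (as i)).prod).mulVec 1}

end MDP

namespace MDP

variable {S A L : Type} [Fintype S] [Fintype A] [Fintype L]
  [DecidableEq S] [DecidableEq A] [DecidableEq L]

/-- `V₂^j = span{M_α(w)·1 : α a memoryless strategy, w ∈ L*, |w| ≤ j}`. -/
def V2le (D : MDP S A L) (j : ℕ) : Submodule ℝ (S → ℝ) :=
  Submodule.span ℝ
    {v | ∃ α, D.IsStrategy α ∧ ∃ w : List L, w.length ≤ j ∧ v = (D.Mword α w).mulVec 1}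

/-- `V₃^j = span{M_α(w)·1 : α an MD strategy, w ∈ L*, |w| ≤ j}`. -/
def V3le (D : MDP S A L) (j : ℕ) : Submodule ℝ (S → ℝ) :=
  Submodule.span ℝ
    {v | ∃ β : S → A, D.IsMD β ∧ ∃ w : List L, w.length ≤ j ∧
      v = (D.Mword (mdStrat β) w).mulVec 1}

end MDP

namespace MDP

variable {S A L : Type} [Fintype S] [Fintype A] [Fintype L]
  [DecidableEq S] [DecidableEq A] [DecidableEq L]

/-- The column-vector space `V₂ = span{M_α(w)·1 : α a memoryless strategy, w ∈ L*}`. -/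
def V2 (D : MDP S A L) : Submodule ℝ (S → ℝ) :=
  Submodule.span ℝ
    {v | ∃ α, D.IsStrategy α ∧ ∃ w : List L, v = (D.Mword α w).mulVec 1}

end MDP

namespace MDP

variable {S A L : Type} [Fintype S] [Fintype A] [Fintype L]
  [DecidableEq S] [DecidableEq A] [DecidableEq L]

/-- `V₁ = span{M_{α₁}(a₁)⋯M_{α_m}(a_m)·1 : m ≥ 0, αᵢ memoryless strategies, aᵢ ∈ L}`. -/
def V1 (D : MDP S A L) : Submodule ℝ (S → ℝ) :=
  Submodule.span ℝ
    {v | ∃ k : ℕ, ∃ (αs : Fin k → S → A → ℝ) (as : Fin k → L),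
      (∀ i, D.IsStrategy (αs i)) ∧
      v = ((List.ofFn fun i => D.Mmat (αs i) (as i)).prod).mulVec 1}

/-- `V₃ = span{M_α(w)·1 : α an MD strategy, w ∈ L*}`. -/
def V3 (D : MDP S A L) : Submodule ℝ (S → ℝ) :=
  Submodule.span ℝ
    {v | ∃ β : S → A, D.IsMD β ∧ ∃ w : List L, v = (D.Mword (mdStrat β) w).mulVec 1}

end MDP

namespace MDP

set_option linter.unusedSectionVars false

variable {S A L : Type} [Fintype S] [Fintype A]
  [DecidableEq S] [DecidableEq A] [DecidableEq L]

theorem Mmat_mulVec_apply (D : MDP S A L) (α : S → A → ℝ) (a : L) (v : S → ℝ) (s : S) :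
    (D.Mmat α a).mulVec v s =
      if D.label s = a then ∑ m, α s m * (D.trans s m ⬝ᵥ v) else 0 := by
  unfold Mmat tau
  simp only [mulVec, dotProduct, of_apply]
  split_ifs
  · simp only [Finset.sum_mul, Finset.mul_sum]
    rw [Finset.sum_comm]
    simp only [mul_assoc]
  · simp

theorem Mmat_mdStrat_mulVec_apply (D : MDP S A L) (β : S → A) (a : L) (v : S → ℝ) (s : S) :
    (D.Mmat (mdStrat β) a).mulVec v s =
      if D.label s = a then D.trans s (β s) ⬝ᵥ v else 0 := by
  rw [Mmat_mulVec_apply]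
  simp [mdStrat]

theorem Mword_cons_mulVec (D : MDP S A L) (α : S → A → ℝ) (a : L) (w : List L) (v : S → ℝ) :
    (D.Mword α (a :: w)).mulVec v = (D.Mmat α a).mulVec ((D.Mword α w).mulVec v) := by
  simp [Mword, mulVec_mulVec]

theorem isStrategy_mdStrat (D : MDP S A L) {β : S → A} (hβ : D.IsMD β) :
    D.IsStrategy (mdStrat β) := by
  intro s
  refine ⟨fun m => ?_, by simp [mdStrat], fun m hm => ?_⟩
  · unfold mdStrat
    split_ifs <;> norm_num
  · have : m ≠ β s := by
      rintro rfl
      simpa [hm] using hβ s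
    simp [mdStrat, this]

theorem IsMD.update {D : MDP S A L} {β : S → A} (hβ : D.IsMD β) {s : S} {m : A}
    (hm : (D.phi s m).isSome) : D.IsMD (Function.update β s m) := by
  intro t
  by_cases h : t = s
  · subst h
    simpa using hm
  · simpa [h] using hβ t

theorem Mword_mdStrat_mulVec_one_mem_V3le (D : MDP S A L) {β : S → A} (hβ : D.IsMD β)
    {w : List L} {j : ℕ} (hw : w.length ≤ j) :
    (D.Mword (mdStrat β) w).mulVec 1 ∈ D.V3le j :=
  Submodule.subset_span ⟨β, hβ, w, hw, rfl⟩

theorem V3le_mono (D : MDP S A L) : Monotone D.V3le := fun _ _ hij =>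
  Submodule.span_mono fun _ ⟨β, hβ, w, hw, hv⟩ => ⟨β, hβ, w, hw.trans hij, hv⟩

theorem V1le_mono (D : MDP S A L) : Monotone D.V1le := fun _ _ hij =>
  Submodule.span_mono fun _ ⟨k, hk, h⟩ => ⟨k, hk.trans hij, h⟩

theorem one_mem_V1le (D : MDP S A L) (j : ℕ) : 1 ∈ D.V1le j :=
  Submodule.subset_span ⟨0, Nat.zero_le j, Fin.elim0, Fin.elim0, fun i => i.elim0, by simp⟩

theorem one_mem_V3le (D : MDP S A L) (hD : D.IsValid) (j : ℕ) : 1 ∈ D.V3le j := by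
  choose β hβ using hD.1
  simpa [Mword] using D.Mword_mdStrat_mulVec_one_mem_V3le hβ (w := []) (Nat.zero_le j)

theorem prod_Mmat_mulVec_one_mem (D : MDP S A L) (W : ℕ → Submodule ℝ (S → ℝ))
    (h1 : 1 ∈ W 0)
    (hW : ∀ i α a v, D.IsStrategy α → v ∈ W i → (D.Mmat α a).mulVec v ∈ W (i + 1)) :
    ∀ (k : ℕ) (αs : Fin k → S → A → ℝ) (as : Fin k → L), (∀ i, D.IsStrategy (αs i)) →
      ((List.ofFn fun i => D.Mmat (αs i) (as i)).prod).mulVec 1 ∈ W k := by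
  intro k
  induction k with
  | zero => intro αs as _; simpa using h1
  | succ k ih =>
    intro αs as h
    rw [List.ofFn_succ, List.prod_cons, ← mulVec_mulVec]
    exact hW _ _ _ _ (h 0) (ih (fun i => αs i.succ) (fun i => as i.succ) fun i => h i.succ)

theorem Mmat_mulVec_mem_V1le (D : MDP S A L) {j : ℕ} {α : S → A → ℝ} (hα : D.IsStrategy α)
    (a : L) {v : S → ℝ} (hv : v ∈ D.V1le j) : (D.Mmat α a).mulVec v ∈ D.V1le (j + 1) := by
  suffices D.V1le j ≤ (D.V1le (j + 1)).comap (D.Mmat α a).mulVecLin from this hv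
  refine Submodule.span_le.2 ?_
  rintro _ ⟨k, hk, αs, as, h, rfl⟩
  refine Submodule.subset_span ⟨k + 1, by omega, Fin.cons α αs, Fin.cons a as, ?_, ?_⟩
  · exact Fin.cases hα h
  · simp [List.ofFn_succ, mulVec_mulVec]

theorem V1_le_of_invariant (D : MDP S A L) (W : Submodule ℝ (S → ℝ)) (h1 : 1 ∈ W)
    (hW : ∀ α a v, D.IsStrategy α → v ∈ W → (D.Mmat α a).mulVec v ∈ W) : D.V1 ≤ W := by
  refine Submodule.span_le.2 ?_
  rintro _ ⟨k, αs, as, h, rfl⟩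
  exact D.prod_Mmat_mulVec_one_mem (fun _ => W) h1 (fun _ => hW) k αs as h

theorem V1le_le_V1 (D : MDP S A L) (j : ℕ) : D.V1le j ≤ D.V1 :=
  Submodule.span_mono fun _ ⟨k, _, h⟩ => ⟨k, h⟩

theorem V3le_le_V3 (D : MDP S A L) (j : ℕ) : D.V3le j ≤ D.V3 :=
  Submodule.span_mono fun _ ⟨β, hβ, w, _, hv⟩ => ⟨β, hβ, w, hv⟩

theorem V3_le_V2 (D : MDP S A L) : D.V3 ≤ D.V2 :=
  Submodule.span_mono fun _ ⟨_, hβ, h⟩ => ⟨_, D.isStrategy_mdStrat hβ, h⟩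

theorem V3le_le_V2le (D : MDP S A L) (j : ℕ) : D.V3le j ≤ D.V2le j :=
  Submodule.span_mono fun _ ⟨_, hβ, h⟩ => ⟨_, D.isStrategy_mdStrat hβ, h⟩

theorem Mword_eq_prod_ofFn (D : MDP S A L) (α : S → A → ℝ) (w : List L) :
    D.Mword α w = (List.ofFn fun i : Fin w.length => D.Mmat α (w.get i)).prod := by
  have h : w.map (D.Mmat α) = List.ofFn fun i : Fin w.length => D.Mmat α (w.get i) := by
    conv_lhs => rw [← List.ofFn_get w, List.map_ofFn]
    rfl
  rw [Mword, h]

theorem V2_le_V1 (D : MDP S A L) : D.V2 ≤ D.V1 :=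
  Submodule.span_mono fun _ ⟨α, hα, w, hv⟩ =>
    ⟨w.length, fun _ => α, w.get, fun _ => hα, by rw [hv, Mword_eq_prod_ofFn]⟩

theorem V2le_le_V1le (D : MDP S A L) (j : ℕ) : D.V2le j ≤ D.V1le j :=
  Submodule.span_mono fun _ ⟨α, hα, w, hw, hv⟩ =>
    ⟨w.length, hw, fun _ => α, w.get, fun _ => hα, by rw [hv, Mword_eq_prod_ofFn]⟩

/-- If all available actions of `s` have the same effect on every `V₃^i` with `i < j`, then
changing an MD strategy at `s` does not change `M_γ(w)·1` for words of length at most `j`. -/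
theorem Mword_update_mulVec_one (D : MDP S A L) {s : S} {j : ℕ}
    (hs : ∀ i < j, ∀ v ∈ D.V3le i, ∀ m m', (D.phi s m).isSome → (D.phi s m').isSome →
      D.trans s m ⬝ᵥ v = D.trans s m' ⬝ᵥ v)
    {γ : S → A} (hγ : D.IsMD γ) {m : A} (hm : (D.phi s m).isSome) (w : List L)
    (hw : w.length ≤ j) :
    (D.Mword (mdStrat (Function.update γ s m)) w).mulVec 1 =
      (D.Mword (mdStrat γ) w).mulVec 1 := by
  induction w with
  | nil => rfl
  | cons b w ih =>
    rw [List.length_cons] at hw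
    rw [Mword_cons_mulVec, Mword_cons_mulVec, ih (by omega)]
    funext t
    rw [Mmat_mdStrat_mulVec_apply, Mmat_mdStrat_mulVec_apply]
    by_cases h : t = s
    · subst h
      rw [Function.update_self, hs w.length (by omega) _
        (D.Mword_mdStrat_mulVec_one_mem_V3le hγ le_rfl) m (γ t) hm (hγ t)]
    · rw [Function.update_of_ne h]

/-- A state at which two available actions differ on `V₃^j` has its unit vector in
`V₃^{j+1}`. -/
theorem single_mem_V3le (D : MDP S A L) (s : S) (j : ℕ) : ∀ v ∈ D.V3le j, ∀ m m',
    (D.phi s m).isSome → (D.phi s m').isSome →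
      D.trans s m ⬝ᵥ v ≠ D.trans s m' ⬝ᵥ v → Pi.single s 1 ∈ D.V3le (j + 1) := by
  induction j using Nat.strong_induction_on with
  | _ j ih =>
  intro v hv m m' hm hm' hne
  by_cases hs : ∀ i < j, ∀ v ∈ D.V3le i, ∀ m m', (D.phi s m).isSome → (D.phi s m').isSome →
      D.trans s m ⬝ᵥ v = D.trans s m' ⬝ᵥ v
  · obtain ⟨γ, hγ, w, hw, hne⟩ : ∃ γ, D.IsMD γ ∧ ∃ w : List L, w.length ≤ j ∧
        D.trans s m ⬝ᵥ (D.Mword (mdStrat γ) w).mulVec 1 ≠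
          D.trans s m' ⬝ᵥ (D.Mword (mdStrat γ) w).mulVec 1 := by
      by_contra! hcon
      apply hne
      unfold V3le at hv
      induction hv using Submodule.span_induction with
      | mem x hx => obtain ⟨γ, hγ, w, hw, rfl⟩ := hx; exact hcon γ hγ w hw
      | zero => simp
      | add x y _ _ hx hy => by_contra h; simp_all [dotProduct_add]
      | smul c x _ hx => by_contra h; simp_all [dotProduct_smul]
    set u := (D.Mword (mdStrat γ) w).mulVec 1 with hu
    have key : ∀ n, (D.phi s n).isSome →
        (D.Mmat (mdStrat (Function.update γ s n)) (D.label s)).mulVec u ∈ D.V3le (j + 1) := by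
      intro n hn
      rw [hu, ← D.Mword_update_mulVec_one hs hγ hn w hw, ← Mword_cons_mulVec]
      exact D.Mword_mdStrat_mulVec_one_mem_V3le (hγ.update hn) (by simpa using hw)
    have hsub := (D.V3le (j + 1)).smul_mem (D.trans s m ⬝ᵥ u - D.trans s m' ⬝ᵥ u)⁻¹
      (sub_mem (key m hm) (key m' hm'))
    convert hsub using 1
    funext t
    simp only [Pi.smul_apply, Pi.sub_apply, Mmat_mdStrat_mulVec_apply, smul_eq_mul]
    by_cases h : t = s
    · subst h
      simp [inv_mul_cancel₀ (sub_ne_zero.2 hne)]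
    · simp [h]
  · push Not at hs
    obtain ⟨i, hi, v, hv, m, m', hm, hm', hne⟩ := hs
    exact D.V3le_mono (by omega) (ih i hi v hv m m' hm hm' hne)

theorem Mmat_mulVec_mem_V3le (D : MDP S A L) {j : ℕ} {α : S → A → ℝ} (hα : D.IsStrategy α)
    (a : L) {v : S → ℝ} (hv : v ∈ D.V3le j) : (D.Mmat α a).mulVec v ∈ D.V3le (j + 1) := by
  suffices D.V3le j ≤ (D.V3le (j + 1)).comap (D.Mmat α a).mulVecLin from this hv
  refine Submodule.span_le.2 ?_
  rintro _ ⟨β, hβ, w, hw, rfl⟩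
  have hu := D.Mword_mdStrat_mulVec_one_mem_V3le hβ hw
  set u := (D.Mword (mdStrat β) w).mulVec 1 with hu'
  have hβu : (D.Mmat (mdStrat β) a).mulVec u ∈ D.V3le (j + 1) := by
    rw [hu', ← Mword_cons_mulVec]
    exact D.Mword_mdStrat_mulVec_one_mem_V3le hβ (by simpa using hw)
  change (D.Mmat α a).mulVec u ∈ D.V3le (j + 1)
  suffices (D.Mmat α a).mulVec u - (D.Mmat (mdStrat β) a).mulVec u ∈ D.V3le (j + 1) by
    simpa using add_mem this hβu
  rw [pi_eq_sum_univ' ((D.Mmat α a).mulVec u - (D.Mmat (mdStrat β) a).mulVec u)]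
  refine sum_mem fun s _ => ?_
  by_cases hs : ∀ m, (D.phi s m).isSome → D.trans s m ⬝ᵥ u = D.trans s (β s) ⬝ᵥ u
  · have hsum : ∑ m, α s m * (D.trans s m ⬝ᵥ u) = D.trans s (β s) ⬝ᵥ u := by
      rw [← one_mul (D.trans s (β s) ⬝ᵥ u), ← (hα s).2.1, Finset.sum_mul]
      refine Finset.sum_congr rfl fun m _ => ?_
      rcases h : D.phi s m with _ | d
      · simp [(hα s).2.2 m h]
      · rw [hs m (by simp [h])]
    simp [Mmat_mulVec_apply D α, Mmat_mdStrat_mulVec_apply, hsum]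
  · push Not at hs
    obtain ⟨m, hm, hne⟩ := hs
    have := D.single_mem_V3le s j u hu m (β s) hm (hβ s) hne
    refine Submodule.smul_mem _ _ ?_
    convert this using 1

theorem V1le_le_V3le (D : MDP S A L) (hD : D.IsValid) (j : ℕ) : D.V1le j ≤ D.V3le j := by
  refine Submodule.span_le.2 ?_
  rintro _ ⟨k, hk, αs, as, h, rfl⟩
  exact D.V3le_mono hk (D.prod_Mmat_mulVec_one_mem D.V3le (D.one_mem_V3le hD 0)
    (fun _ _ a _ hα hv => D.Mmat_mulVec_mem_V3le hα a hv) k αs as h)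

theorem V1_le_V1le_or_lt_finrank [Nonempty S] (D : MDP S A L) (j : ℕ) :
    D.V1 ≤ D.V1le j ∨ j < Module.finrank ℝ (D.V1le j) := by
  induction j with
  | zero =>
    right
    have : Nontrivial (D.V1le 0) :=
      Submodule.nontrivial_iff_ne_bot.2 ((Submodule.ne_bot_iff _).2
        ⟨1, D.one_mem_V1le 0, one_ne_zero⟩)
    exact Module.finrank_pos
  | succ j ih =>
    rcases ih with h | h
    · exact Or.inl (h.trans (D.V1le_mono (Nat.le_add_right j 1)))
    · by_cases heq : D.V1le j = D.V1le (j + 1)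
      · left
        rw [← heq]
        refine D.V1_le_of_invariant _ (D.one_mem_V1le j) fun α a v hα hv => ?_
        rw [heq]
        exact D.Mmat_mulVec_mem_V1le hα a hv
      · right
        have := Submodule.finrank_lt_finrank_of_lt
          (lt_of_le_of_ne (D.V1le_mono (Nat.le_add_right j 1)) heq)
        omega

theorem V1_le_V1le_card_sub_one (D : MDP S A L) : D.V1 ≤ D.V1le (Fintype.card S - 1) := by
  rcases isEmpty_or_nonempty S with _ | _
  · intro v _
    rw [Subsingleton.elim v 0]
    exact zero_mem _
  · rcases D.V1_le_V1le_or_lt_finrank (Fintype.card S - 1) with h | h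
    · exact h
    · have hle := Submodule.finrank_le (D.V1le (Fintype.card S - 1))
      rw [Module.finrank_fintype_fun_eq_card] at hle
      rw [Submodule.eq_top_of_finrank_eq (S := D.V1le (Fintype.card S - 1))
        (by rw [Module.finrank_fintype_fun_eq_card]; omega)]
      exact le_top

end MDP

namespace MDP

variable {S A L : Type} [Fintype S] [Fintype A] [Fintype L]
  [DecidableEq S] [DecidableEq A] [DecidableEq L]

/-- the vector spaces `V₁`, `V₂`, `V₃`, `V₁^{|S|-1}`, `V₂^{|S|-1}` and
`V₃^{|S|-1}` are all equal. -/
theorem v1_eq_v2_eq_v3_eq_length_restricted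
    (D : MDP S A L) (hD : D.IsValid) :
    D.V1 = D.V2 ∧ D.V2 = D.V3 ∧ D.V3 = D.V1le (Fintype.card S - 1) ∧
      D.V1le (Fintype.card S - 1) = D.V2le (Fintype.card S - 1) ∧
      D.V2le (Fintype.card S - 1) = D.V3le (Fintype.card S - 1) := by
  have h12 := D.V1_le_V1le_card_sub_one
  have h13 := D.V1le_le_V3le hD (Fintype.card S - 1)
  have h3 := D.V3le_le_V3 (Fintype.card S - 1)
  have h32 := D.V3_le_V2
  have h21 := D.V2_le_V1
  have h32' := D.V3le_le_V2le (Fintype.card S - 1)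
  have h21' := D.V2le_le_V1le (Fintype.card S - 1)
  refine ⟨le_antisymm ?_ h21, le_antisymm ?_ h32, le_antisymm ?_ (h13.trans h3),
    le_antisymm (h13.trans h32') h21', le_antisymm (h21'.trans h13) h32'⟩
  · exact h12.trans (h13.trans (h3.trans h32))
  · exact h21.trans (h12.trans (h13.trans h3))
  · exact h32.trans (h21.trans h12)

end MDP
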